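/- arXiv:2103.15097 — 2 statements merged into one kernel-verified Lean document; each statement's English description precedes it below -/
import Mathlib

section
/- Let A ∈ ℂ^{n×n} have eigenvalues λ_1,…,λ_n. Then the eigenvalues of the k-additive compound A^{[k]} are exactly the sums λ_{i_1}+λ_{i_2}+⋯+λ_{i_k} over all 1 ≤ i_1 < i_2 < ⋯ < i_k ≤ n. -/
open Matrix

/-- The `k`-multiplicative compound of a matrix: the matrix of all `k × k` minors,
indexed by the `k`-element subsets of the row and column index sets (ordered
increasingly / lexicographically). -/
noncomputable def mulCompound {𝕜 : Type*} [CommRing 𝕜] {n m : ℕ}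
    (A : Matrix (Fin n) (Fin m) 𝕜) (k : ℕ) :
    Matrix {s : Finset (Fin n) // s.card = k} {t : Finset (Fin m) // t.card = k} 𝕜 :=
  fun α β => (A.submatrix (α.1.orderEmbOfFin α.2) (β.1.orderEmbOfFin β.2)).det

/-- The `k`-additive compound: `A^{[k]} := (d/dε) (I + ε A)^{(k)} |_{ε = 0}`. -/
noncomputable def addCompound {𝕜 : Type*} [NontriviallyNormedField 𝕜] {n : ℕ}
    (A : Matrix (Fin n) (Fin n) 𝕜) (k : ℕ) :
    Matrix {s : Finset (Fin n) // s.card = k} {s : Finset (Fin n) // s.card = k} 𝕜 :=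
  fun α β => deriv (fun ε : 𝕜 => mulCompound (1 + ε • A) k α β) 0

section MulCompound

variable {𝕜 : Type*} [CommRing 𝕜] {n : ℕ}

variable (𝕜 n) in
/-- The basis of the `k`-th exterior power of `𝕜ⁿ` induced by the standard basis. -/
noncomputable def exteriorPowerStdBasis (k : ℕ) :
    Module.Basis {s : Finset (Fin n) // s.card = k} 𝕜 (⋀[𝕜]^k (Fin n → 𝕜)) :=
  ((Pi.basisFun 𝕜 (Fin n)).exteriorPower k).reindex (Equiv.subtypeEquivRight fun _ => Iff.rfl)

theorem mulCompound_eq_toMatrix (A : Matrix (Fin n) (Fin n) 𝕜) (k : ℕ) :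
    mulCompound A k = LinearMap.toMatrix (exteriorPowerStdBasis 𝕜 n k)
      (exteriorPowerStdBasis 𝕜 n k) (exteriorPower.map k (toLin' A)) := by
  ext α β
  rw [LinearMap.toMatrix_apply, exteriorPowerStdBasis, Module.Basis.reindex_apply,
    Module.Basis.repr_reindex_apply, exteriorPower.basis_apply,
    exteriorPower.map_apply_ιMulti_family, exteriorPower.basis_repr_apply,
    exteriorPower.ιMulti_family, exteriorPower.ιMultiDual_apply_ιMulti, mulCompound,
    ← det_transpose]
  congr 1
  ext i j
  simp [Set.powersetCard.ofFinEmbEquiv_symm_apply]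
  rfl

/-- The Cauchy–Binet formula for square matrices. -/
theorem mulCompound_mul (A B : Matrix (Fin n) (Fin n) 𝕜) (k : ℕ) :
    mulCompound (A * B) k = mulCompound A k * mulCompound B k := by
  simp only [mulCompound_eq_toMatrix, toLin'_mul, ← LinearMap.toMatrix_comp,
    exteriorPower.map_comp]

theorem mulCompound_one (k : ℕ) : mulCompound (1 : Matrix (Fin n) (Fin n) 𝕜) k = 1 := by
  rw [mulCompound_eq_toMatrix, toLin'_one, exteriorPower.map_id, LinearMap.toMatrix_id]

theorem Matrix.IsUpperTriangular.mulCompound_eq_zero {T : Matrix (Fin n) (Fin n) 𝕜}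
    (hT : T.IsUpperTriangular) {k : ℕ} {α β : {s : Finset (Fin n) // s.card = k}}
    (h : ∑ i ∈ β.1, 2 ^ (i : ℕ) < ∑ i ∈ α.1, 2 ^ (i : ℕ)) :
    mulCompound T k α β = 0 := by
  rw [mulCompound, det_apply]
  refine Finset.sum_eq_zero fun σ _ => ?_
  suffices ∃ i, β.1.orderEmbOfFin β.2 i < α.1.orderEmbOfFin α.2 (σ i) by
    obtain ⟨i, hi⟩ := this
    rw [Finset.prod_eq_zero (Finset.mem_univ i) (hT hi), smul_zero]
  by_contra! hle
  have sum_eq (γ : {s : Finset (Fin n) // s.card = k}) :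
      ∑ i ∈ γ.1, 2 ^ (i : ℕ) = ∑ i, 2 ^ (γ.1.orderEmbOfFin γ.2 i : ℕ) := by
    conv_lhs => rw [← γ.1.map_orderEmbOfFin_univ γ.2, Finset.sum_map]
    rfl
  rw [sum_eq, sum_eq, ← Equiv.sum_comp σ fun i => 2 ^ (α.1.orderEmbOfFin α.2 i : ℕ)] at h
  exact h.not_ge (Finset.sum_le_sum fun i _ => Nat.pow_le_pow_right two_pos (hle i))

theorem Matrix.IsUpperTriangular.mulCompound_diag {T : Matrix (Fin n) (Fin n) 𝕜}
    (hT : T.IsUpperTriangular) {k : ℕ} (α : {s : Finset (Fin n) // s.card = k}) :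
    mulCompound T k α α = ∏ i ∈ α.1, T i i := by
  have h : (T.submatrix (α.1.orderEmbOfFin α.2) (α.1.orderEmbOfFin α.2)).IsUpperTriangular :=
    fun i j hij => hT ((α.1.orderEmbOfFin α.2).strictMono hij)
  rw [mulCompound, det_of_isUpperTriangular h]
  conv_rhs => rw [← α.1.map_orderEmbOfFin_univ α.2, Finset.prod_map]
  rfl

end MulCompound

section AddCompound

variable {𝕜 : Type*} [NontriviallyNormedField 𝕜] {n : ℕ}

theorem differentiable_mulCompound_one_add_smul (A : Matrix (Fin n) (Fin n) 𝕜) (k : ℕ)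
    (α β : {s : Finset (Fin n) // s.card = k}) :
    Differentiable 𝕜 fun ε : 𝕜 => mulCompound (1 + ε • A) k α β := by
  simp only [mulCompound, det_apply', submatrix_apply, Matrix.add_apply, Matrix.smul_apply, smul_eq_mul]
  fun_prop

theorem addCompound_conj {P Q : Matrix (Fin n) (Fin n) 𝕜} (hPQ : P * Q = 1)
    (A : Matrix (Fin n) (Fin n) 𝕜) (k : ℕ) :
    addCompound (P * A * Q) k = mulCompound P k * addCompound A k * mulCompound Q k := by
  have key (ε : 𝕜) : mulCompound (1 + ε • (P * A * Q)) k =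
      mulCompound P k * mulCompound (1 + ε • A) k * mulCompound Q k := by
    rw [← mulCompound_mul, ← mulCompound_mul, mul_add, add_mul, mul_one, hPQ,
      Matrix.mul_smul, Matrix.smul_mul]
  have hd := fun α β => (differentiable_mulCompound_one_add_smul A k α β).differentiableAt (x := 0)
  ext α β
  simp only [addCompound, key, mul_apply, Finset.sum_mul]
  rw [deriv_fun_sum fun γ _ => by fun_prop]
  refine Finset.sum_congr rfl fun γ _ => ?_
  rw [deriv_fun_sum fun δ _ => by fun_prop]
  refine Finset.sum_congr rfl fun δ _ => ?_
  rw [deriv_mul_const (by fun_prop), deriv_const_mul _ (by fun_prop)]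

theorem Matrix.IsUpperTriangular.one_add_smul {T : Matrix (Fin n) (Fin n) 𝕜}
    (hT : T.IsUpperTriangular) (ε : 𝕜) : (1 + ε • T).IsUpperTriangular := fun i j h => by
  have hij : i ≠ j := ne_of_gt h
  simp [one_apply_ne hij, hT h]

theorem Matrix.IsUpperTriangular.addCompound_eq_zero {T : Matrix (Fin n) (Fin n) 𝕜}
    (hT : T.IsUpperTriangular) {k : ℕ} {α β : {s : Finset (Fin n) // s.card = k}}
    (h : ∑ i ∈ β.1, 2 ^ (i : ℕ) < ∑ i ∈ α.1, 2 ^ (i : ℕ)) :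
    addCompound T k α β = 0 := by
  simp only [addCompound, (hT.one_add_smul _).mulCompound_eq_zero h, deriv_const]

theorem Matrix.IsUpperTriangular.addCompound_diag {T : Matrix (Fin n) (Fin n) 𝕜}
    (hT : T.IsUpperTriangular) {k : ℕ} (α : {s : Finset (Fin n) // s.card = k}) :
    addCompound T k α α = ∑ i ∈ α.1, T i i := by
  simp only [addCompound, (hT.one_add_smul _).mulCompound_diag, Matrix.add_apply, one_apply_eq,
    Matrix.smul_apply, smul_eq_mul]
  have h (i : Fin n) : HasDerivAt (fun ε : 𝕜 => 1 + ε * T i i) (T i i) 0 := by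
    simpa using ((hasDerivAt_id (0 : 𝕜)).mul_const (T i i)).const_add 1
  rw [(HasDerivAt.fun_finsetProd fun i _ => h i).deriv]
  simp

theorem Matrix.BlockTriangular.charpoly_of_injective {R ι κ : Type*} [CommRing R] [Fintype ι]
    [DecidableEq ι] [LinearOrder κ] {M : Matrix ι ι R} {w : ι → κ} (h : M.BlockTriangular w)
    (hw : Function.Injective w) :
    M.charpoly = ∏ i, (Polynomial.X - Polynomial.C (M i i)) := by
  let _ : LinearOrder ι := LinearOrder.lift' w hw
  have hM : M.IsUpperTriangular := fun i j hij => h hij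
  convert! charpoly_of_isUpperTriangular M hM

theorem Matrix.IsUpperTriangular.charpoly_addCompound {T : Matrix (Fin n) (Fin n) 𝕜}
    (hT : T.IsUpperTriangular) (k : ℕ) :
    (addCompound T k).charpoly =
      ∏ α : {s : Finset (Fin n) // s.card = k},
        (Polynomial.X - Polynomial.C (∑ i ∈ α.1, T i i)) := by
  let w (α : {s : Finset (Fin n) // s.card = k}) : ℕ := ∑ i ∈ α.1, 2 ^ (i : ℕ)
  have hw : Function.Injective w := fun α β h => by
    refine Subtype.ext (Finset.map_injective Fin.valEmbedding
      (Finset.geomSum_injective le_rfl ?_))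
    simpa [w] using h
  have h : (addCompound T k).BlockTriangular w := fun α β h => hT.addCompound_eq_zero h
  simp_rw [← hT.addCompound_diag]
  exact h.charpoly_of_injective hw

end AddCompound

section Triangularization

variable {K V : Type*} [Field K] [IsAlgClosed K] [AddCommGroup V] [Module K V]
  [FiniteDimensional K V]

/-- Every endomorphism of a finite-dimensional space over an algebraically closed field is
represented by a lower triangular matrix in a suitable basis. -/
theorem LinearMap.exists_basis_repr_eq_zero_of_lt {n : ℕ} (hn : Module.finrank K V = n)
    (f : V →ₗ[K] V) :
    ∃ b : Module.Basis (Fin n) K V, ∀ i j, j < i → b.repr (f (b i)) j = 0 := by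
  induction n generalizing V with
  | zero => exact ⟨Module.finBasisOfFinrankEq K V hn, fun i => i.elim0⟩
  | succ n ih =>
    have : Nontrivial V := Module.nontrivial_of_finrank_pos (R := K) (by omega)
    obtain ⟨μ, hμ⟩ := Module.End.exists_eigenvalue (f.dualMap : Module.End K (Module.Dual K V))
    obtain ⟨φ, hφ⟩ := hμ.exists_hasEigenvector
    have hφf (x : V) : φ (f x) = μ * φ x := by
      simpa using LinearMap.congr_fun hφ.apply_eq_smul x
    have hmem : ∀ x ∈ LinearMap.ker φ, f x ∈ LinearMap.ker φ := fun x hx => by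
      rw [LinearMap.mem_ker] at hx ⊢
      rw [hφf, hx, mul_zero]
    obtain ⟨b, hb⟩ := ih (V := LinearMap.ker φ)
      (by have := Module.Dual.finrank_ker_add_one_of_ne_zero hφ.2; omega) (f.restrict hmem)
    obtain ⟨y, hy⟩ : ∃ y, φ y ≠ 0 := by
      by_contra! h
      exact hφ.2 (LinearMap.ext h)
    let c : Module.Basis (Fin (n + 1)) K V := Module.Basis.mkFinCons y b
      (fun a x hx h => by
        have := congrArg φ h
        simpa [LinearMap.mem_ker.mp hx, hy] using this)
      (fun z => ⟨-(φ z / φ y), by simp [hy]⟩)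
    have hc (i : Fin n) : c i.succ = b i := by simp [c]
    refine ⟨c, Fin.cases (fun j h => absurd h (Fin.not_lt_zero j)) fun i => ?_⟩
    have hfc : f (c i.succ) = ∑ l, b.repr (f.restrict hmem (b i)) l • c l.succ := by
      simp only [hc, ← Submodule.coe_smul, ← Submodule.coe_sum, b.sum_repr]
      rfl
    intro j hj
    rw [hfc]
    simp only [map_sum, map_smul, Module.Basis.repr_self, Finsupp.coe_finsetSum,
      Finset.sum_apply, Finsupp.coe_smul, Pi.smul_apply, smul_eq_mul, Finsupp.single_apply]
    refine Finset.sum_eq_zero fun l _ => ?_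
    split_ifs with h
    · subst h
      rw [hb i l (Fin.succ_lt_succ_iff.mp hj), zero_mul]
    · rw [mul_zero]

/-- Every square matrix over an algebraically closed field is similar to an upper triangular
matrix. -/
theorem Matrix.exists_isUpperTriangular_conj {n : ℕ} (A : Matrix (Fin n) (Fin n) K) :
    ∃ P Q T : Matrix (Fin n) (Fin n) K,
      P * Q = 1 ∧ Q * P = 1 ∧ T.IsUpperTriangular ∧ A = P * T * Q := by
  obtain ⟨b, hb⟩ := (toLin' A).exists_basis_repr_eq_zero_of_lt (Module.finrank_fin_fun K)
  let c := b.reindex Fin.revPerm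
  let e := Pi.basisFun K (Fin n)
  refine ⟨e.toMatrix c, c.toMatrix e, LinearMap.toMatrix c c (toLin' A),
    e.toMatrix_mul_toMatrix_flip c, c.toMatrix_mul_toMatrix_flip e, fun i j h => ?_, ?_⟩
  · simpa [LinearMap.toMatrix_apply, c] using hb j.rev i.rev (Fin.rev_lt_rev.mpr h)
  · rw [basis_toMatrix_mul_linearMap_toMatrix_mul_basis_toMatrix]
    exact (LinearMap.toMatrix'_toLin' A).symm

end Triangularization

theorem charpoly_conj_of_mul_eq_one {R ι : Type*} [CommRing R] [Fintype ι] [DecidableEq ι]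
    {P Q : Matrix ι ι R} (hQP : Q * P = 1) (A : Matrix ι ι R) :
    (P * A * Q).charpoly = A.charpoly := by
  rw [charpoly_mul_comm, ← mul_assoc, hQP, one_mul]

theorem map_sum_subsets_eq_map_sum_powersetCard {ι M : Type*} [Fintype ι] [DecidableEq ι]
    [AddCommMonoid M] (f : ι → M) (k : ℕ) :
    (Finset.univ : Finset {s : Finset ι // s.card = k}).val.map (fun α => ∑ i ∈ α.1, f i) =
      ((Finset.univ.val.map f).powersetCard k).map Multiset.sum := by
  have h : (Finset.univ : Finset {s : Finset ι // s.card = k}).map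
      (Function.Embedding.subtype _) = Finset.univ.powersetCard k := by
    ext s
    simp [Finset.mem_powersetCard]
  rw [Multiset.powersetCard_map, ← Finset.map_val_val_powersetCard, ← h]
  simp only [Finset.map_val, Multiset.map_map]
  rfl

theorem roots_prod_X_sub_C_apply {R ι : Type*} [CommRing R] [IsDomain R] [Fintype ι]
    (f : ι → R) :
    (∏ i, (Polynomial.X - Polynomial.C (f i))).roots = Finset.univ.val.map f := by
  rw [← Polynomial.roots_multiset_prod_X_sub_C (Finset.univ.val.map f), Multiset.map_map]
  rfl

/-- If `A` has eigenvalues `λ₁, …, λₙ` (with multiplicity, as roots of the characteristic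
polynomial), then the eigenvalues of the additive compound `A^{[k]}` are exactly the sums of
the eigenvalues over all increasing `k`-tuples of indices. -/
theorem addCompound_eigenvalues {n : ℕ} (A : Matrix (Fin n) (Fin n) ℂ) (lam : Fin n → ℂ)
    (hlam : A.charpoly.roots = (Finset.univ.val : Multiset (Fin n)).map lam)
    (k : ℕ) (hk1 : 1 ≤ k) (hk : k ≤ n) :
    (addCompound A k).charpoly.roots =
      ((Finset.univ : Finset {s : Finset (Fin n) // s.card = k}).val).map
        (fun α => ∑ i ∈ α.1, lam i) := by
  obtain ⟨P, Q, T, hPQ, hQP, hT, rfl⟩ := A.exists_isUpperTriangular_conj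
  rw [charpoly_conj_of_mul_eq_one hQP, charpoly_of_isUpperTriangular T hT,
    roots_prod_X_sub_C_apply] at hlam
  rw [addCompound_conj hPQ, charpoly_conj_of_mul_eq_one
    (by rw [← mulCompound_mul, hQP, mulCompound_one]), hT.charpoly_addCompound,
    roots_prod_X_sub_C_apply, map_sum_subsets_eq_map_sum_powersetCard, hlam,
    ← map_sum_subsets_eq_map_sum_powersetCard]
end

section
/- Let A ∈ ℝ^{n×n} be nonsingular and k ∈ {1,…,n}. The following are equivalent: (i) for every x ∈ ℝ^n with s^-(x) ≤ k−1, one has s^-(Ax) ≤ k−1; (ii) A is sign-regular of order k, i.e., all k×k minors of A are nonnegative, or all are nonpositive. -/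
open Matrix

/-- Number of sign changes in a list of reals (consecutive pairs of opposite sign). -/
noncomputable def signChanges : List ℝ → ℕ
  | [] => 0
  | [_] => 0
  | a :: b :: rest => (if a * b < 0 then 1 else 0) + signChanges (b :: rest)

/-- `s⁻(x)`: the number of sign variations in `x` after deleting its zero entries
(`s⁻(0) = 0`). -/
noncomputable def sminus {n : ℕ} (x : Fin n → ℝ) : ℕ :=
  signChanges ((List.ofFn x).filter (fun a => a ≠ 0))

/-- `s⁺(x)`: the maximal possible number of sign variations in `x` after setting every zero
entry of `x` to either `+1` or `-1`. -/
noncomputable def splus {n : ℕ} (x : Fin n → ℝ) : ℕ :=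
  sSup { m | ∃ y : Fin n → ℝ, (∀ i, x i ≠ 0 → y i = x i) ∧
      (∀ i, x i = 0 → y i = 1 ∨ y i = -1) ∧ m = signChanges (List.ofFn y) }

/-- A list without zeros contains an alternating sublist, starting at its head, with as many
sign changes as the list itself. -/
theorem exists_alternating_sublist (l : List ℝ) : ∀ b : ℝ, (∀ a ∈ b :: l, a ≠ 0) →
    ∃ t : List ℝ, t.Sublist l ∧ (b :: t).IsChain (fun a c => a * c < 0) ∧
      t.length = signChanges (b :: l) := by
  induction l with
  | nil => exact fun b _ => ⟨[], by simp [signChanges]⟩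
  | cons c l ih =>
    intro b hb
    obtain ⟨t, ht, hchain, hlen⟩ := ih c fun a ha => hb a (List.mem_cons_of_mem _ ha)
    by_cases hbc : b * c < 0
    · refine ⟨c :: t, ht.cons_cons c, List.isChain_cons_cons.2 ⟨hbc, hchain⟩, ?_⟩
      simp [signChanges, hbc, hlen, add_comm]
    · refine ⟨t, ht.cons c, ?_, by simp [signChanges, hbc, hlen]⟩
      have hc : c ≠ 0 := hb c (by simp)
      have hb0 : b ≠ 0 := hb b (by simp)
      have hpos : 0 < b * c := lt_of_le_of_ne (not_lt.1 hbc) (mul_ne_zero hb0 hc).symm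
      cases t with
      | nil => simp
      | cons d t =>
        rw [List.isChain_cons_cons] at hchain ⊢
        refine ⟨?_, hchain.2⟩
        by_contra hbd
        nlinarith [mul_nonneg hpos.le (not_lt.1 hbd), mul_pos_of_neg_of_neg hchain.1 hchain.1,
          mul_neg_of_pos_of_neg (mul_self_pos.2 hb0) hchain.1]

theorem exists_alternating_of_le_sminus {n k : ℕ} (x : Fin n → ℝ) (hk : 1 ≤ k)
    (h : k ≤ sminus x) : ∃ f : Fin (k + 1) → Fin n, StrictMono f ∧
      ∀ i : Fin k, x (f i.castSucc) * x (f i.succ) < 0 := by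
  unfold sminus at h
  set l := (List.ofFn x).filter (fun a => a ≠ 0) with hl
  have hsub : l.Sublist (List.ofFn x) := List.filter_sublist
  have hne : ∀ a ∈ l, a ≠ 0 := by simp [hl]
  clear_value l
  obtain ⟨u, hu, hchain, hlen⟩ : ∃ u : List ℝ, u.Sublist (List.ofFn x) ∧
      u.IsChain (fun a c => a * c < 0) ∧ k + 1 ≤ u.length := by
    cases l with
    | nil => simp only [signChanges] at h; omega
    | cons b l =>
      obtain ⟨t, ht, hchain, hlen⟩ := exists_alternating_sublist l b hne
      exact ⟨b :: t, (ht.cons_cons b).trans hsub, hchain, by simp; omega⟩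
  obtain ⟨φ, hφ⟩ := List.sublist_iff_exists_fin_orderEmbedding_get_eq.1 hu
  refine ⟨fun i => Fin.cast (List.length_ofFn) (φ (Fin.castLE hlen i)), ?_, fun i => ?_⟩
  · intro i j hij
    exact φ.strictMono hij
  · have key (j : Fin u.length) : x (Fin.cast List.length_ofFn (φ j)) = u.get j := by
      rw [hφ, List.get_ofFn]
    rw [key, key]
    have := List.isChain_iff_getElem.1 hchain i (by have := i.2; omega)
    simpa using this

/-- Every list of reals admits a compatible list of nonzero signs with equally many sign
changes. -/
theorem exists_sign_extension (l : List ℝ) :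
    ∃ e : List ℝ, List.Forall₂ (fun s a => (s = 1 ∨ s = -1) ∧ 0 ≤ s * a) e l ∧
      signChanges e = signChanges (l.filter (fun a => a ≠ 0)) ∧
      ∀ a t, l.filter (fun a => a ≠ 0) = a :: t → ∃ b u, e = b :: u ∧ 0 < b * a := by
  induction l with
  | nil => exact ⟨[], by simp⟩
  | cons a l ih =>
    obtain ⟨e, he, hs, hh⟩ := ih
    by_cases ha : a = 0
    · subst ha
      cases e with
      | nil =>
        cases he
        exact ⟨[1], by simp [signChanges]⟩
      | cons b u =>
        refine ⟨b :: b :: u, ?_, ?_, ?_⟩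
        · refine List.Forall₂.cons ⟨?_, by simp⟩ he
          cases he with
          | cons h _ => exact h.1
        · simpa [signChanges, not_lt.2 (mul_self_nonneg b)] using hs
        · intro a t hat
          obtain ⟨b', u', heq, hpos⟩ := hh a t (by simpa using hat)
          refine ⟨b, b :: u, rfl, ?_⟩
          cases heq
          exact hpos
    · obtain ⟨s, hs1, hsa⟩ : ∃ s : ℝ, (s = 1 ∨ s = -1) ∧ 0 < s * a := by
        rcases lt_or_gt_of_ne ha with h | h
        · exact ⟨-1, by simp, by linarith⟩
        · exact ⟨1, by simp, by linarith⟩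
      have hfilter : (a :: l).filter (fun a => a ≠ 0) = a :: l.filter (fun a => a ≠ 0) := by
        simp [ha]
      rw [hfilter]
      cases hl : l.filter (fun a => a ≠ 0) with
      | nil =>
        refine ⟨s :: l.map fun _ => s, List.Forall₂.cons ⟨hs1, hsa.le⟩ ?_, ?_, ?_⟩
        · rw [List.forall₂_map_left_iff, List.forall₂_same]
          intro b hb
          have : b = 0 := by
            by_contra hb0
            have : b ∈ l.filter (fun a => a ≠ 0) := by simp [hb, hb0]
            rw [hl] at this
            simp at this
          exact ⟨hs1, by simp [this]⟩
        · have (m : List ℝ) : signChanges (s :: m.map fun _ => s) = 0 := by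
            induction m with
            | nil => rfl
            | cons _ m ih => simpa [signChanges, not_lt.2 (mul_self_nonneg s)] using ih
          rw [this]; rfl
        · rintro _ _ ⟨⟩
          exact ⟨s, _, rfl, hsa⟩
      | cons a' t =>
        obtain ⟨b, u, rfl, hb⟩ := hh a' t hl
        refine ⟨s :: b :: u, List.Forall₂.cons ⟨hs1, hsa.le⟩ he, ?_, ?_⟩
        · have : s * b < 0 ↔ a * a' < 0 := by
            have h1 : 0 < (s * b) * (a * a') := by nlinarith
            constructor <;> intro h <;> by_contra h' <;> nlinarith
          rw [hl] at hs
          simp [signChanges, this, hs]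
        · rintro _ _ ⟨⟩
          exact ⟨s, _, rfl, hsa⟩

theorem signChanges_eq_card (l : List ℝ) : signChanges l =
    ((Finset.range (l.length - 1)).filter fun i => l.getD i 0 * l.getD (i + 1) 0 < 0).card := by
  rw [Finset.card_filter]
  induction l with
  | nil => rfl
  | cons a l ih =>
    cases l with
    | nil => rfl
    | cons b l =>
      have : (a :: b :: l).length - 1 = ((b :: l).length - 1) + 1 := by simp
      rw [this, Finset.sum_range_succ', signChanges, ih, add_comm]
      simp

/-- A vector with fewer than `k` sign changes splits into `k` nonempty consecutive blocks of
weakly constant sign. -/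
theorem exists_blocks {n k : ℕ} (x : Fin n → ℝ) (hk1 : 1 ≤ k) (hk : k ≤ n)
    (h : sminus x ≤ k - 1) : ∃ (g : Fin n → Fin k) (c : Fin k → ℝ),
      Monotone g ∧ Function.Surjective g ∧ ∀ i, (c (g i) = 1 ∨ c (g i) = -1) ∧
        0 ≤ c (g i) * x i := by
  obtain ⟨e, he, hs, -⟩ := exists_sign_extension (List.ofFn x)
  have hlen : e.length = n := by simpa using he.length_eq
  have hsign (i : ℕ) (hi : i < n) :
      (e.getD i 0 = 1 ∨ e.getD i 0 = -1) ∧ 0 ≤ e.getD i 0 * x ⟨i, hi⟩ := by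
    have := (List.forall₂_iff_get.1 he).2 i (by omega) (by simpa using hi)
    rw [List.getD_eq_getElem e 0 (hlen.symm ▸ hi)]
    simpa using this
  rw [sminus, ← hs, signChanges_eq_card, hlen] at h
  obtain ⟨S, hsub, hS, hcard⟩ := Finset.exists_subsuperset_card_eq
    (Finset.filter_subset _ (Finset.range (n - 1))) h (by simp; omega)
  let g : ℕ → ℕ := fun i => (S.filter (· < i)).card
  have g_zero : g 0 = 0 := by simp [g]
  have g_mono : Monotone g := fun i j hij =>
    Finset.card_le_card fun a ha => by
      simp only [Finset.mem_filter] at ha ⊢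
      exact ⟨ha.1, ha.2.trans_le hij⟩
  have g_last : g (n - 1) = k - 1 := by
    have : S.filter (· < n - 1) = S :=
      Finset.filter_true_of_mem fun a ha => Finset.mem_range.1 (hS ha)
    simp only [g, this, hcard]
  have g_succ (i : ℕ) : g (i + 1) = g i + if i ∈ S then 1 else 0 := by
    simp only [g, Finset.card_filter, Order.lt_add_one_iff, le_iff_lt_or_eq]
    rw [← Finset.sum_ite_eq' S i fun _ => 1, ← Finset.sum_add_distrib]
    refine Finset.sum_congr rfl fun a _ => ?_
    rcases lt_trichotomy a i with h | h | h
    · simp [h, h.ne]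
    · simp [h]
    · simp [h.not_gt, h.ne']
  have g_lt (i : Fin n) : g i < k := by
    have : g i ≤ g (n - 1) := g_mono (by omega)
    omega
  have e_const (i j : ℕ) (hij : i ≤ j) (hj : j < n) (hg : g i = g j) :
      e.getD i 0 = e.getD j 0 := by
    induction j, hij using Nat.le_induction with
    | base => rfl
    | succ j hij ih =>
      have h1 := g_mono hij
      have h2 := g_succ j
      have hjS : j ∉ S := fun hjS => by simp [hjS] at h2; omega
      simp only [hjS, if_false, add_zero] at h2
      rw [ih (by omega) (by omega)]
      have h3 : ¬ e.getD j 0 * e.getD (j + 1) 0 < 0 := fun hlt =>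
        hjS (hsub (Finset.mem_filter.2 ⟨Finset.mem_range.2 (by omega), hlt⟩))
      rcases (hsign j (by omega)).1 with h4 | h4 <;>
        rcases (hsign (j + 1) hj).1 with h5 | h5 <;> rw [h4, h5] at h3 ⊢ <;> norm_num at h3
  have surj (j : Fin k) : ∃ i : Fin n, g i = j := by
    have hex : ∃ i, (j : ℕ) ≤ g i := ⟨n - 1, by omega⟩
    have hle : Nat.find hex ≤ n - 1 := Nat.find_min' hex (by omega)
    refine ⟨⟨Nat.find hex, by omega⟩, le_antisymm ?_ (Nat.find_spec hex)⟩
    change g (Nat.find hex) ≤ j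
    rcases hi : Nat.find hex with _ | i
    · omega
    · have h1 := Nat.find_min hex (m := i) (by omega)
      have h2 := g_succ i
      split_ifs at h2 <;> omega
  choose r hr using surj
  refine ⟨fun i => ⟨g i, g_lt i⟩, fun j => e.getD (r j) 0, fun i j hij => g_mono hij,
    fun j => ⟨r j, Fin.ext (hr j)⟩, fun i => ?_⟩
  have hri := hr ⟨g i, g_lt i⟩
  have : e.getD (r ⟨g i, g_lt i⟩) 0 = e.getD i 0 := by
    rcases le_total (r ⟨g i, g_lt i⟩ : ℕ) i with h | h
    · exact e_const _ _ h i.2 hri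
    · exact (e_const _ _ h (Fin.is_lt _) hri.symm).symm
  simp only [this]
  exact hsign i i.2

open Classical in
/-- The **Cauchy–Binet formula**. -/
theorem det_mul_eq_sum_strictMono {R : Type*} [CommRing R] {k n : ℕ}
    (P : Matrix (Fin k) (Fin n) R) (Q : Matrix (Fin n) (Fin k) R) :
    (P * Q).det = ∑ f : Fin k → Fin n with StrictMono f,
      (P.submatrix id f).det * (Q.submatrix f id).det := by
  have expand : (P * Q).det =
      ∑ p : Fin k → Fin n, (∏ i, Q (p i) i) * (P.submatrix id p).det := by
    simp only [det_apply', mul_apply, Finset.prod_univ_sum, Finset.mul_sum,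
      Fintype.piFinset_univ]
    rw [Finset.sum_comm]
    refine Finset.sum_congr rfl fun p _ => Finset.sum_congr rfl fun σ _ => ?_
    simp only [submatrix_apply, id, Finset.prod_mul_distrib]
    ring
  have inner (f : Fin k → Fin n) : (P.submatrix id f).det * (Q.submatrix f id).det =
      ∑ σ : Equiv.Perm (Fin k),
        (∏ i, Q (f (σ i)) i) * (P.submatrix id (f ∘ σ)).det := by
    rw [det_apply' (Q.submatrix f id), Finset.mul_sum]
    refine Finset.sum_congr rfl fun σ _ => ?_
    have := det_permute' σ (P.submatrix id f)
    rw [submatrix_submatrix] at this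
    simp only [Function.comp_id] at this
    rw [this]
    simp only [submatrix_apply, id]
    ring
  have drop : ∑ p : Fin k → Fin n, (∏ i, Q (p i) i) * (P.submatrix id p).det =
      ∑ p : Fin k → Fin n with Function.Injective p,
        (∏ i, Q (p i) i) * (P.submatrix id p).det := by
    refine (Finset.sum_subset (Finset.filter_subset _ _) fun p _ hp => ?_).symm
    rw [Finset.mem_filter_univ, Function.not_injective_iff] at hp
    obtain ⟨i, j, hij, hne⟩ := hp
    rw [det_zero_of_column_eq hne fun a => by simp [hij], mul_zero]
  rw [expand, drop, Finset.sum_congr rfl fun f _ => inner f, ← Finset.sum_product']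
  symm
  refine Finset.sum_bij (fun q _ => q.1 ∘ q.2) ?_ ?_ ?_ fun _ _ => rfl
  · rintro ⟨f, σ⟩ h
    simp only [Finset.mem_product, Finset.mem_filter_univ] at h
    simpa using h.1.injective.comp σ.injective
  · rintro ⟨f, σ⟩ h ⟨g, τ⟩ h' e
    simp only [Finset.mem_product, Finset.mem_filter_univ] at h h'
    simp only at e
    have hfg : f = g := (StrictMono.range_inj h.1 h'.1).1 <| by
      rw [← σ.surjective.range_comp f, ← τ.surjective.range_comp g, e]
    subst hfg
    exact Prod.ext rfl (Equiv.ext fun i => h.1.injective (congrFun e i))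
  · intro p hp
    simp only [Finset.mem_filter_univ] at hp
    refine ⟨(p ∘ Tuple.sort p, (Tuple.sort p)⁻¹), ?_, ?_⟩
    · simpa using (Tuple.monotone_sort p).strictMono_of_injective
        (hp.comp (Tuple.sort p).injective)
    · ext i
      simp

/-- Cauchy matrices of positive, strictly decreasing nodes have positive determinant. -/
theorem det_cauchy_pos {k : ℕ} (x y : Fin k → ℝ) (hx : StrictAnti x) (hy : StrictAnti y)
    (hx0 : ∀ i, 0 < x i) (hy0 : ∀ i, 0 < y i) :
    0 < (Matrix.of fun i j => (x i + y j)⁻¹).det := by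
  induction k with
  | zero => simp
  | succ k ih =>
    let B : Matrix (Fin (k + 1)) (Fin (k + 1)) ℝ := Matrix.of fun i j =>
      if i = 0 then (x 0 + y j)⁻¹
      else (x 0 - x i) / (x i + y 0) * ((y 0 - y j) / (x 0 + y j) * (x i + y j)⁻¹)
    have hp i j : x i + y j ≠ 0 := (add_pos (hx0 i) (hy0 j)).ne'
    have key : (Matrix.of fun i j => (x i + y j)⁻¹).det = B.det := by
      refine det_eq_of_forall_row_eq_smul_add_const
        (fun i => if i = 0 then 0 else (x 0 + y 0) / (x i + y 0)) 0 (by simp) fun i j => ?_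
      by_cases hi : i = 0
      · subst hi; simp [B]
      · have h1 := hp i j
        have h2 := hp i 0
        have h3 := hp 0 j
        simp only [B, hi, of_apply, if_false, if_true]
        field_simp
        ring
    have hB : B.det = (x 0 + y 0)⁻¹ * (B.submatrix Fin.succ Fin.succ).det := by
      rw [det_succ_column_zero, Fin.sum_univ_succ, Finset.sum_eq_zero]
      · simp [B, Fin.succAbove_zero]
      · intro i _
        simp [B]
    have hS : (B.submatrix Fin.succ Fin.succ).det =
        (∏ i : Fin k, (x 0 - x i.succ) / (x i.succ + y 0)) *
        ((∏ j : Fin k, (y 0 - y j.succ) / (x 0 + y j.succ)) *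
          (Matrix.of fun i j : Fin k => (x i.succ + y j.succ)⁻¹).det) := by
      rw [← det_mul_row, ← det_mul_column]
      congr 1
    rw [key, hB, hS]
    have hxs (i : Fin k) : x i.succ < x 0 := hx (Fin.succ_pos i)
    have hys (i : Fin k) : y i.succ < y 0 := hy (Fin.succ_pos i)
    refine mul_pos (inv_pos.2 (add_pos (hx0 _) (hy0 _))) (mul_pos ?_ (mul_pos ?_ ?_))
    · exact Finset.prod_pos fun i _ =>
        div_pos (sub_pos.2 (hxs i)) (add_pos (hx0 _) (hy0 _))
    · exact Finset.prod_pos fun i _ =>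
        div_pos (sub_pos.2 (hys i)) (add_pos (hx0 _) (hy0 _))
    · exact ih (fun i => x i.succ) (fun i => y i.succ)
        (fun i j h => hx (Fin.succ_lt_succ_iff.2 h)) (fun i j h => hy (Fin.succ_lt_succ_iff.2 h))
        (fun i => hx0 _) fun i => hy0 _

/-- If the maximal minors of `W` are nonzero of one common sign, no vector in the column space
of `W` has an alternating subsequence longer than the number of columns. -/
theorem not_alternating_of_minors_pos {n k : ℕ} (W : Matrix (Fin n) (Fin k) ℝ) (σ : ℝ)
    (hW : ∀ f : Fin k → Fin n, StrictMono f → 0 < σ * (W.submatrix f id).det)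
    (hkpos : 0 < k) (c : Fin k → ℝ) (f : Fin (k + 1) → Fin n) (hf : StrictMono f) :
    ¬ ∀ i : Fin k, (W *ᵥ c) (f i.castSucc) * (W *ᵥ c) (f i.succ) < 0 := by
  intro halt
  set z := W *ᵥ c with hz
  let M : Matrix (Fin (k + 1)) (Fin (k + 1)) ℝ :=
    Matrix.of fun i => Fin.cons (z (f i)) fun j => W (f i) j
  have hM : M.det = 0 := by
    rw [← exists_mulVec_eq_zero_iff]
    refine ⟨Fin.cons (-1) c, fun h => ?_, ?_⟩
    · simpa using congrFun h 0
    · ext i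
      simp [M, mulVec, dotProduct, Fin.sum_univ_succ, hz]
  have hz0 : z (f 0) ≠ 0 := by
    have := halt ⟨0, hkpos⟩
    intro h0
    have e : (Fin.castSucc ⟨0, hkpos⟩ : Fin (k + 1)) = 0 := rfl
    rw [e, h0, zero_mul] at this
    exact lt_irrefl _ this
  have hsign (i : Fin (k + 1)) : 0 < z (f 0) * ((-1) ^ (i : ℕ) * z (f i)) := by
    induction i using Fin.induction with
    | zero => simpa using mul_self_pos.2 hz0
    | succ i ih =>
      have h := halt i
      simp only [Fin.val_castSucc, Fin.val_succ, pow_succ] at ih ⊢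
      by_contra hcon
      have hsq : ((-1 : ℝ) ^ (i : ℕ)) * (-1) ^ (i : ℕ) = 1 := by
        rw [← mul_pow]; simp
      have h1 : 0 ≤ z (f 0) * ((-1) ^ (i : ℕ) * z (f i.succ)) := by linarith
      have h2 := mul_nonneg ih.le h1
      have h3 : z (f 0) * ((-1) ^ (i : ℕ) * z (f i.castSucc)) *
          (z (f 0) * ((-1) ^ (i : ℕ) * z (f i.succ))) =
          (z (f 0) * z (f 0)) * (z (f i.castSucc) * z (f i.succ)) := by
        linear_combination (z (f 0) * z (f 0)) * (z (f i.castSucc) * z (f i.succ)) * hsq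
      rw [h3] at h2
      exact absurd (mul_neg_of_pos_of_neg (mul_self_pos.2 hz0) h) (not_lt.2 h2)
  have hsum : 0 < ∑ i : Fin (k + 1), z (f 0) * ((-1) ^ (i : ℕ) * z (f i)) *
      (σ * (W.submatrix (f ∘ i.succAbove) id).det) :=
    Finset.sum_pos (fun i _ => mul_pos (hsign i)
      (hW _ (hf.comp (Fin.strictMono_succAbove i)))) Finset.univ_nonempty
  have hexp : M.det = ∑ i : Fin (k + 1), (-1) ^ (i : ℕ) * z (f i) *
      (W.submatrix (f ∘ i.succAbove) id).det := by
    rw [det_succ_column_zero]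
    rfl
  have : ∑ i : Fin (k + 1), z (f 0) * ((-1) ^ (i : ℕ) * z (f i)) *
      (σ * (W.submatrix (f ∘ i.succAbove) id).det) = z (f 0) * σ * M.det := by
    rw [hexp, Finset.mul_sum]
    exact Finset.sum_congr rfl fun i _ => by ring
  rw [this, hM, mul_zero] at hsum
  exact lt_irrefl _ hsum

/-- A vector with fewer than `k` sign changes lies in the column space of a matrix with `k`
columns whose maximal minors are nonnegative and not all zero. -/
theorem exists_eq_mulVec_of_sminus_le {n k : ℕ} (x : Fin n → ℝ) (hk1 : 1 ≤ k) (hk : k ≤ n)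
    (h : sminus x ≤ k - 1) : ∃ (V : Matrix (Fin n) (Fin k) ℝ) (c : Fin k → ℝ), x = V *ᵥ c ∧
      (∀ f : Fin k → Fin n, StrictMono f → 0 ≤ (V.submatrix f id).det) ∧
      ∃ f : Fin k → Fin n, StrictMono f ∧ (V.submatrix f id).det ≠ 0 := by
  classical
  obtain ⟨g, s, hg, hsurj, hs⟩ := exists_blocks x hk1 hk h
  let isZero (j : Fin k) : Prop := ∀ i, g i = j → x i = 0
  let w (i : Fin n) : ℝ := if isZero (g i) then 1 else |x i|
  have hw (i : Fin n) : 0 ≤ w i := by simp only [w]; split_ifs <;> positivity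
  have hrep (j : Fin k) : ∃ i, g i = j ∧ w i ≠ 0 := by
    by_cases hj : isZero j
    · obtain ⟨i, rfl⟩ := hsurj j
      exact ⟨i, rfl, by simp [w, hj]⟩
    · have hj' := hj
      simp only [isZero, not_forall] at hj'
      obtain ⟨i, rfl, hi⟩ := hj'
      exact ⟨i, rfl, by simpa [w, hj] using hi⟩
  choose r hr hrw using hrep
  let V : Matrix (Fin n) (Fin k) ℝ := Matrix.of fun i j => if g i = j then w i else 0
  have hdiag (f : Fin k → Fin n) (hgf : ∀ a, g (f a) = a) :
      (V.submatrix f id).det = ∏ a, w (f a) := by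
    have : V.submatrix f id = Matrix.diagonal fun a => w (f a) := by
      ext a b
      simp [V, hgf, diagonal_apply]
    rw [this, det_diagonal]
  refine ⟨V, fun j => if isZero j then 0 else s j, ?_, fun f hf => ?_, r, ?_, ?_⟩
  · ext i
    simp only [V, mulVec, dotProduct, of_apply, ite_mul, zero_mul, Finset.sum_ite_eq,
      Finset.mem_univ, if_true, w]
    by_cases hj : isZero (g i)
    · simp [hj, hj i rfl]
    · simp only [hj, if_false]
      obtain ⟨h1 | h1, h2⟩ := hs i <;> rw [h1] at h2 ⊢
      · rw [abs_of_nonneg (by linarith), mul_one]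
      · rw [abs_of_nonpos (by linarith), mul_neg_one, neg_neg]
  · by_cases hgf : Function.Surjective (g ∘ f)
    · have hmono : StrictMono (g ∘ f) := (hg.comp hf.monotone).strictMono_of_injective
        (Finite.injective_iff_surjective.2 hgf)
      have hid : g ∘ f = id := by
        refine (StrictMono.range_inj hmono strictMono_id).1 ?_
        rw [hgf.range_eq, Set.range_id]
      rw [hdiag f fun a => congrFun hid a]
      exact Finset.prod_nonneg fun a _ => hw _
    · simp only [Function.Surjective, not_forall, not_exists] at hgf
      obtain ⟨j, hj⟩ := hgf
      refine (det_eq_zero_of_column_eq_zero j fun a => ?_).ge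
      simpa [V] using fun h => absurd h (hj a)
  · intro a b hab
    by_contra hcon
    have := hg (not_lt.1 hcon)
    rw [hr, hr] at this
    exact absurd hab (not_lt.2 this)
  · rw [hdiag r hr]
    exact Finset.prod_ne_zero_iff.2 fun a _ => hrw a

theorem det_mul_pos_of_minors {k n : ℕ} (P : Matrix (Fin k) (Fin n) ℝ)
    (Q : Matrix (Fin n) (Fin k) ℝ) (σ : ℝ)
    (hP : ∀ f : Fin k → Fin n, StrictMono f → 0 < (P.submatrix id f).det)
    (hQ : ∀ f : Fin k → Fin n, StrictMono f → 0 ≤ σ * (Q.submatrix f id).det)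
    (hQ' : ∃ f : Fin k → Fin n, StrictMono f ∧ σ * (Q.submatrix f id).det ≠ 0) :
    0 < σ * (P * Q).det := by
  classical
  obtain ⟨f, hf, hne⟩ := hQ'
  rw [det_mul_eq_sum_strictMono, Finset.mul_sum]
  refine Finset.sum_pos' (fun g hg => ?_) ⟨f, by simpa using hf, ?_⟩
  · rw [mul_left_comm]
    exact mul_nonneg (hP g (by simpa using hg)).le (hQ g (by simpa using hg))
  · rw [mul_left_comm]
    exact mul_pos (hP f hf) (lt_of_le_of_ne (hQ f hf) hne.symm)

/-- The `k × n` scaled Cauchy matrix with row nodes `x` and column nodes `r ^ (2 * i)`. -/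
noncomputable def cauchyRows {k : ℕ} (n : ℕ) (r : ℝ) (x : Fin k → ℝ) :
    Matrix (Fin k) (Fin n) ℝ :=
  Matrix.of fun a i => r ^ (i : ℕ) * (x a + r ^ (2 * (i : ℕ)))⁻¹

theorem strictAnti_pow_two_mul {n : ℕ} {r : ℝ} (hr0 : 0 < r) (hr1 : r < 1) :
    StrictAnti fun i : Fin n => r ^ (2 * (i : ℕ)) := fun i j hij =>
  pow_lt_pow_right_of_lt_one₀ hr0 hr1 (by have : (i : ℕ) < j := hij; omega)

theorem det_cauchyRows_submatrix_pos {k n : ℕ} {r : ℝ} (hr0 : 0 < r) (hr1 : r < 1)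
    {x : Fin k → ℝ} (hx : StrictAnti x) (hx0 : ∀ a, 0 < x a) (f : Fin k → Fin n)
    (hf : StrictMono f) : 0 < ((cauchyRows n r x).submatrix id f).det := by
  have : ((cauchyRows n r x).submatrix id f).det = (∏ b, r ^ (f b : ℕ)) *
      (Matrix.of fun a b => (x a + r ^ (2 * (f b : ℕ)))⁻¹).det := by
    rw [← det_mul_row]
    rfl
  rw [this]
  exact mul_pos (Finset.prod_pos fun _ _ => by positivity)
    (det_cauchy_pos _ _ hx ((strictAnti_pow_two_mul hr0 hr1).comp_strictMono hf) hx0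
      fun _ => by positivity)

/-- A strictly totally positive kernel (for `0 < r < 1`) degenerating to the identity at
`r = 0`. -/
noncomputable def sechKernel (n : ℕ) (r : ℝ) : Matrix (Fin n) (Fin n) ℝ :=
  Matrix.of fun i j => 2 * r ^ Nat.dist i j / (1 + (r ^ Nat.dist i j) ^ 2)

theorem sechKernel_zero (n : ℕ) : sechKernel n 0 = 1 := by
  ext i j
  by_cases h : i = j
  · subst h
    norm_num [sechKernel, Nat.dist_self]
  · have : Nat.dist i j ≠ 0 := fun h' => h (Fin.ext (Nat.eq_of_dist_eq_zero h'))
    simp [sechKernel, h, this]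

theorem continuous_sechKernel (n : ℕ) : Continuous (sechKernel n) := by
  refine continuous_matrix fun i j => ?_
  simp only [sechKernel, of_apply]
  refine Continuous.div (by fun_prop) (by fun_prop) fun r => ?_
  positivity

theorem sechKernel_isSymm (n : ℕ) (r : ℝ) : (sechKernel n r)ᵀ = sechKernel n r := by
  ext i j
  simp [sechKernel, Nat.dist_comm]

theorem sechKernel_submatrix {k n : ℕ} {r : ℝ} (hr : 0 < r) (f : Fin k → Fin n) :
    (sechKernel n r).submatrix f id = Matrix.diagonal (fun a => 2 * r ^ (f a : ℕ)) *
      cauchyRows n r fun a => r ^ (2 * (f a : ℕ)) := by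
  ext a i
  simp only [sechKernel, cauchyRows, submatrix_apply, id, of_apply, diagonal_mul]
  have key (p q : ℕ) (h : p ≤ q) : 2 * r ^ Nat.dist p q / (1 + (r ^ Nat.dist p q) ^ 2) =
      2 * r ^ p * (r ^ q * (r ^ (2 * p) + r ^ (2 * q))⁻¹) := by
    obtain ⟨d, rfl⟩ := Nat.exists_eq_add_of_le h
    rw [Nat.dist_eq_sub_of_le h, Nat.add_sub_cancel_left]
    have h1 : (1 : ℝ) + (r ^ d) ^ 2 ≠ 0 := by positivity
    have h2 : r ^ (2 * p) + r ^ (2 * (p + d)) = (r ^ p) ^ 2 * (1 + (r ^ d) ^ 2) := by ring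
    rw [h2, pow_add]
    have h3 : r ^ p ≠ 0 := by positivity
    field_simp
  rcases le_total (f a : ℕ) i with h | h
  · exact key _ _ h
  · rw [Nat.dist_comm, key _ _ h]
    ring

theorem sechKernel_minor_pos {k n : ℕ} {r : ℝ} (hr0 : 0 < r) (hr1 : r < 1)
    (f : Fin k → Fin n) (hf : StrictMono f) (g : Fin k → Fin n) (hg : StrictMono g) :
    0 < (((sechKernel n r).submatrix f id).submatrix id g).det := by
  rw [sechKernel_submatrix hr0]
  have : (Matrix.diagonal (fun a => 2 * r ^ (f a : ℕ)) *
      cauchyRows n r fun a => r ^ (2 * (f a : ℕ))).submatrix id g =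
      Matrix.diagonal (fun a => 2 * r ^ (f a : ℕ)) *
      (cauchyRows n r fun a => r ^ (2 * (f a : ℕ))).submatrix id g := by
    ext; simp
  rw [this, det_mul, det_diagonal]
  exact mul_pos (Finset.prod_pos fun _ _ => by positivity)
    (det_cauchyRows_submatrix_pos hr0 hr1 ((strictAnti_pow_two_mul hr0 hr1).comp_strictMono hf)
      (fun _ => pow_pos hr0 _) g hg)

theorem exists_minor_ne_zero_of_mul {n k : ℕ} (A : Matrix (Fin n) (Fin n) ℝ)
    (hA : IsUnit A.det) (V : Matrix (Fin n) (Fin k) ℝ)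
    (hV : ∃ f : Fin k → Fin n, StrictMono f ∧ (V.submatrix f id).det ≠ 0) :
    ∃ f : Fin k → Fin n, StrictMono f ∧ ((A * V).submatrix f id).det ≠ 0 := by
  classical
  by_contra! hcon
  obtain ⟨f, -, hne⟩ := hV
  refine hne ?_
  have : V.submatrix f id = A⁻¹.submatrix f id * (A * V) := by
    rw [← submatrix_id_id (A * V), ← submatrix_mul _ _ _ _ _ Function.bijective_id,
      nonsing_inv_mul_cancel_left _ _ hA]
  rw [this, det_mul_eq_sum_strictMono]
  refine Finset.sum_eq_zero fun g hg => ?_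
  rw [hcon g (by simpa using hg), mul_zero]

theorem sminus_mulVec_le_of_minors {n k : ℕ} (A : Matrix (Fin n) (Fin n) ℝ)
    (hA : IsUnit A.det) (hk1 : 1 ≤ k) (hk : k ≤ n) (σ : ℝ) (hσ : σ ≠ 0)
    (hmin : ∀ f g : Fin k → Fin n, StrictMono f → StrictMono g →
      0 ≤ σ * (A.submatrix f g).det)
    (x : Fin n → ℝ) (hx : sminus x ≤ k - 1) : sminus (A *ᵥ x) ≤ k - 1 := by
  classical
  by_contra hcon
  obtain ⟨f, hf, halt⟩ := exists_alternating_of_le_sminus (A *ᵥ x) hk1 (by omega)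
  obtain ⟨V, c, rfl, hV, hV'⟩ := exists_eq_mulVec_of_sminus_le x hk1 hk hx
  have hAV (g : Fin k → Fin n) (hg : StrictMono g) :
      0 ≤ σ * ((A * V).submatrix g id).det := by
    rw [submatrix_mul _ _ _ _ _ Function.bijective_id, submatrix_id_id,
      det_mul_eq_sum_strictMono, Finset.mul_sum]
    refine Finset.sum_nonneg fun p hp => ?_
    have hp : StrictMono p := by simpa using hp
    rw [← mul_assoc]
    exact mul_nonneg (hmin g p hg hp) (hV p hp)
  obtain ⟨p, hp, hpne⟩ := exists_minor_ne_zero_of_mul A hA V hV'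
  have hcont (i : Fin k) : ∀ᶠ r in nhdsWithin (0 : ℝ) (Set.Ioi 0),
      ((sechKernel n r * (A * V)) *ᵥ c) (f i.castSucc) *
        ((sechKernel n r * (A * V)) *ᵥ c) (f i.succ) < 0 := by
    have hc : Continuous fun r => ((sechKernel n r * (A * V)) *ᵥ c) :=
      ((continuous_sechKernel n).matrix_mul continuous_const).matrix_mulVec continuous_const
    have hc' : Continuous fun r => ((sechKernel n r * (A * V)) *ᵥ c) (f i.castSucc) *
        ((sechKernel n r * (A * V)) *ᵥ c) (f i.succ) :=
      (continuous_pi_iff.1 hc _).mul (continuous_pi_iff.1 hc _)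
    refine nhdsWithin_le_nhds (hc'.continuousAt.eventually_lt continuousAt_const ?_)
    simpa [sechKernel_zero] using halt i
  have hall := (Filter.eventually_all.2 hcont).and
    (Ioo_mem_nhdsGT (zero_lt_one (α := ℝ)))
  obtain ⟨r, hr, hr0, hr1⟩ := hall.exists
  refine not_alternating_of_minors_pos (sechKernel n r * (A * V)) σ (fun g hg => ?_) hk1 c f hf hr
  rw [submatrix_mul _ _ _ _ _ Function.bijective_id, submatrix_id_id]
  exact det_mul_pos_of_minors _ _ σ (fun q hq => sechKernel_minor_pos hr0 hr1 g hg q hq) hAV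
    ⟨p, hp, mul_ne_zero hσ hpne⟩

theorem det_cauchyRows_mul_ne_zero {n k : ℕ} (A : Matrix (Fin n) (Fin n) ℝ)
    (hA : IsUnit A.det) (hk1 : 1 ≤ k) (hk : k ≤ n)
    (h : ∀ x : Fin n → ℝ, sminus x ≤ k - 1 → sminus (A *ᵥ x) ≤ k - 1)
    {r : ℝ} (hr0 : 0 < r) (hr1 : r < 1) {x y : Fin k → ℝ} (hx : StrictAnti x)
    (hx0 : ∀ a, 0 < x a) (hy : StrictAnti y) (hy0 : ∀ a, 0 < y a) :
    (cauchyRows n r x * A * (cauchyRows n r y)ᵀ).det ≠ 0 := by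
  intro hdet
  obtain ⟨c, hc, hker⟩ := exists_mulVec_eq_zero_iff.2 hdet
  have hQ (f : Fin k → Fin n) (hf : StrictMono f) :
      0 < ((cauchyRows n r y)ᵀ.submatrix f id).det := by
    rw [← transpose_submatrix, det_transpose]
    exact det_cauchyRows_submatrix_pos hr0 hr1 hy hy0 f hf
  have hz : sminus ((cauchyRows n r y)ᵀ *ᵥ c) ≤ k - 1 := by
    by_contra hcon
    obtain ⟨f, hf, halt⟩ :=
      exists_alternating_of_le_sminus ((cauchyRows n r y)ᵀ *ᵥ c) hk1 (by omega)
    exact not_alternating_of_minors_pos _ 1 (fun g hg => by simpa using hQ g hg) hk1 c f hf halt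
  obtain ⟨V, d, hVd, hV, hV'⟩ := exists_eq_mulVec_of_sminus_le _ hk1 hk (h _ hz)
  have hPV : 0 < 1 * (cauchyRows n r x * V).det :=
    det_mul_pos_of_minors _ _ 1
      (fun f hf => det_cauchyRows_submatrix_pos hr0 hr1 hx hx0 f hf)
      (by simpa using hV) (by simpa using hV')
  rw [one_mul] at hPV
  rw [← mulVec_mulVec, ← mulVec_mulVec, hVd, mulVec_mulVec] at hker
  have hd : d = 0 := eq_zero_of_mulVec_eq_zero hPV.ne' hker
  rw [hd, mulVec_zero] at hVd
  have hz0 := eq_zero_of_mulVec_eq_zero hA.ne_zero hVd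
  have hemb : StrictMono (Fin.castLE hk) := Fin.strictMono_castLE hk
  refine hc (eq_zero_of_mulVec_eq_zero (hQ _ hemb).ne' ?_)
  ext a
  exact congrFun hz0 (Fin.castLE hk a)

theorem convex_strictAnti_pos (k : ℕ) :
    Convex ℝ {x : Fin k → ℝ | StrictAnti x ∧ ∀ a, 0 < x a} := by
  intro x hx y hy s t hs ht hst
  have key (a b c d : ℝ) (h1 : a < b) (h2 : c < d) : s * a + t * c < s * b + t * d := by
    rcases hs.eq_or_lt with rfl | hs
    · have : t = 1 := by linarith
      subst this; linarith
    · nlinarith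
  refine ⟨fun i j hij => ?_, fun i => ?_⟩
  · simpa using key _ _ _ _ (hx.1 hij) (hy.1 hij)
  · simpa using key 0 _ 0 _ (hx.2 i) (hy.2 i)

theorem cauchyRows_mul_det_same_sign {n k : ℕ} (A : Matrix (Fin n) (Fin n) ℝ)
    (hA : IsUnit A.det) (hk1 : 1 ≤ k) (hk : k ≤ n)
    (h : ∀ x : Fin n → ℝ, sminus x ≤ k - 1 → sminus (A *ᵥ x) ≤ k - 1)
    {r : ℝ} (hr0 : 0 < r) (hr1 : r < 1) {x y x' y' : Fin k → ℝ}
    (hx : StrictAnti x ∧ ∀ a, 0 < x a) (hy : StrictAnti y ∧ ∀ a, 0 < y a)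
    (hx' : StrictAnti x' ∧ ∀ a, 0 < x' a) (hy' : StrictAnti y' ∧ ∀ a, 0 < y' a)
    (hneg : (cauchyRows n r x * A * (cauchyRows n r y)ᵀ).det < 0)
    (hpos : 0 < (cauchyRows n r x' * A * (cauchyRows n r y')ᵀ).det) : False := by
  let C := {x : Fin k → ℝ | StrictAnti x ∧ ∀ a, 0 < x a}
  have hconn : IsPreconnected (C ×ˢ C) :=
    ((convex_strictAnti_pos k).prod (convex_strictAnti_pos k)).isPreconnected
  have hcauchy : ContinuousOn (fun x : Fin k → ℝ => cauchyRows n r x) C := by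
    refine continuousOn_pi.2 fun a => continuousOn_pi.2 fun i => ?_
    simp only [cauchyRows, of_apply]
    refine continuousOn_const.mul (ContinuousOn.inv₀ (by fun_prop) fun x hx => ?_)
    have := hx.2 a
    positivity
  have hD : ContinuousOn (fun p : (Fin k → ℝ) × (Fin k → ℝ) =>
      (cauchyRows n r p.1 * A * (cauchyRows n r p.2)ᵀ).det) (C ×ˢ C) := by
    have h1 : ContinuousOn (fun p : (Fin k → ℝ) × (Fin k → ℝ) => cauchyRows n r p.1) (C ×ˢ C) :=
      hcauchy.comp continuousOn_fst fun p hp => hp.1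
    have h2 : ContinuousOn (fun p : (Fin k → ℝ) × (Fin k → ℝ) => cauchyRows n r p.2) (C ×ˢ C) :=
      hcauchy.comp continuousOn_snd fun p hp => hp.2
    rw [continuousOn_iff_continuous_domRestrict] at h1 h2 ⊢
    exact ((h1.matrix_mul continuous_const).matrix_mul h2.matrix_transpose).matrix_det
  obtain ⟨p, hp, hp0⟩ := hconn.intermediate_value (a := (x, y)) (b := (x', y'))
    ⟨hx, hy⟩ ⟨hx', hy'⟩ hD ⟨hneg.le, hpos.le⟩
  exact det_cauchyRows_mul_ne_zero A hA hk1 hk h hr0 hr1 hp.1.1 hp.1.2 hp.2.1 hp.2.2 hp0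

theorem minors_same_sign {n k : ℕ} (A : Matrix (Fin n) (Fin n) ℝ)
    (hA : IsUnit A.det) (hk1 : 1 ≤ k) (hk : k ≤ n)
    (h : ∀ x : Fin n → ℝ, sminus x ≤ k - 1 → sminus (A *ᵥ x) ≤ k - 1)
    {f g f' g' : Fin k → Fin n} (hf : StrictMono f) (hg : StrictMono g)
    (hf' : StrictMono f') (hg' : StrictMono g')
    (hneg : (A.submatrix f g).det < 0) (hpos : 0 < (A.submatrix f' g').det) : False := by
  have hc (p q : Fin k → Fin n) : Continuous fun r =>
      ((sechKernel n r * A * sechKernel n r).submatrix p q).det :=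
    ((((continuous_sechKernel n).matrix_mul continuous_const).matrix_mul
      (continuous_sechKernel n)).matrix_submatrix p q).matrix_det
  have h1 : ∀ᶠ r in nhdsWithin (0 : ℝ) (Set.Ioi 0),
      ((sechKernel n r * A * sechKernel n r).submatrix f g).det < 0 :=
    nhdsWithin_le_nhds ((hc f g).continuousAt.eventually_lt continuousAt_const
      (by simpa [sechKernel_zero] using hneg))
  have h2 : ∀ᶠ r in nhdsWithin (0 : ℝ) (Set.Ioi 0),
      0 < ((sechKernel n r * A * sechKernel n r).submatrix f' g').det :=
    nhdsWithin_le_nhds (continuousAt_const.eventually_lt (hc f' g').continuousAt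
      (by simpa [sechKernel_zero] using hpos))
  obtain ⟨r, ⟨hr1, hr2⟩, hr0, hrlt⟩ :=
    ((h1.and h2).and (Ioo_mem_nhdsGT (zero_lt_one (α := ℝ)))).exists
  have hfactor (p q : Fin k → Fin n) :
      ((sechKernel n r * A * sechKernel n r).submatrix p q).det =
      (∏ a, 2 * r ^ (p a : ℕ)) * (∏ a, 2 * r ^ (q a : ℕ)) *
        (cauchyRows n r (fun a => r ^ (2 * (p a : ℕ))) * A *
          (cauchyRows n r fun a => r ^ (2 * (q a : ℕ)))ᵀ).det := by
    have hq : (sechKernel n r).submatrix id q = ((sechKernel n r).submatrix q id)ᵀ := by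
      rw [transpose_submatrix, sechKernel_isSymm]
    rw [submatrix_mul _ _ _ _ _ Function.bijective_id,
      submatrix_mul _ _ _ _ _ Function.bijective_id, hq, sechKernel_submatrix hr0,
      sechKernel_submatrix hr0, submatrix_id_id, transpose_mul, diagonal_transpose,
      ← Matrix.mul_assoc, Matrix.mul_assoc (Matrix.diagonal _), Matrix.mul_assoc (Matrix.diagonal _),
      det_mul, det_mul, det_diagonal, det_diagonal]
    ring
  have hprod (p q : Fin k → Fin n) :
      0 < (∏ a, 2 * r ^ (p a : ℕ)) * (∏ a, 2 * r ^ (q a : ℕ)) :=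
    mul_pos (Finset.prod_pos fun _ _ => by positivity) (Finset.prod_pos fun _ _ => by positivity)
  have hnode {p : Fin k → Fin n} (hp : StrictMono p) :
      StrictAnti (fun a => r ^ (2 * (p a : ℕ))) ∧ ∀ a, 0 < r ^ (2 * (p a : ℕ)) :=
    ⟨(strictAnti_pow_two_mul hr0 hrlt).comp_strictMono hp, fun _ => by positivity⟩
  rw [hfactor] at hr1 hr2
  exact cauchyRows_mul_det_same_sign A hA hk1 hk h hr0 hrlt (hnode hf) (hnode hg) (hnode hf')
    (hnode hg') (neg_of_mul_neg_right hr1 (hprod f g).le)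
    (pos_of_mul_pos_right hr2 (hprod _ _).le)

/-- A nonsingular `A` preserves the set of vectors with at most `k-1` sign variations
(counted by `s⁻`) iff `A` is sign-regular of order `k` (all `k × k` minors nonnegative,
or all nonpositive). -/
theorem sminus_invariant_iff_sign_regular {n : ℕ} (A : Matrix (Fin n) (Fin n) ℝ)
    (hA : IsUnit A.det) (k : ℕ) (hk1 : 1 ≤ k) (hk : k ≤ n) :
    (∀ x : Fin n → ℝ, sminus x ≤ k - 1 → sminus (A.mulVec x) ≤ k - 1) ↔
      ((∀ α β : {s : Finset (Fin n) // s.card = k},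
          0 ≤ (A.submatrix (α.1.orderEmbOfFin α.2) (β.1.orderEmbOfFin β.2)).det) ∨
        (∀ α β : {s : Finset (Fin n) // s.card = k},
          (A.submatrix (α.1.orderEmbOfFin α.2) (β.1.orderEmbOfFin β.2)).det ≤ 0)) := by
  constructor
  · intro h
    by_contra! hcon
    obtain ⟨⟨α, β, hneg⟩, ⟨α', β', hpos⟩⟩ := hcon
    exact minors_same_sign A hA hk1 hk h (OrderEmbedding.strictMono _)
      (OrderEmbedding.strictMono _) (OrderEmbedding.strictMono _)
      (OrderEmbedding.strictMono _) hneg hpos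
  · have hemb (f : Fin k → Fin n) (hf : StrictMono f) :
        ∃ α : {s : Finset (Fin n) // s.card = k}, f = α.1.orderEmbOfFin α.2 :=
      ⟨⟨Finset.univ.map ⟨f, hf.injective⟩, by simp⟩,
        Finset.orderEmbOfFin_unique _ (by simp) hf⟩
    rintro (h | h)
    · refine sminus_mulVec_le_of_minors A hA hk1 hk 1 one_ne_zero fun f g hf hg => ?_
      obtain ⟨α, rfl⟩ := hemb f hf
      obtain ⟨β, rfl⟩ := hemb g hg
      linarith [h α β]
    · refine sminus_mulVec_le_of_minors A hA hk1 hk (-1) (by norm_num) fun f g hf hg => ?_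
      obtain ⟨α, rfl⟩ := hemb f hf
      obtain ⟨β, rfl⟩ := hemb g hg
      linarith [h α β]
end
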